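/- For every d ≥ 1, the probability that the two-way collision probability of a uniformly random state deviates from its mean by more than 1/(100d) satisfies σ({ψ ∈ S : |p_ψ − 2/(d+1)| ≥ 1/(100d)}) ≤ 40000/d. -/

import Mathlib

open MeasureTheory

noncomputable section

/-- The unit sphere of `ℂ^d`. -/
abbrev unitSphere (d : ℕ) : Type := Metric.sphere (0 : EuclideanSpace ℂ (Fin d)) 1

/-- The action of a (complex-linear) isometric equivalence of `ℂ^d` on the unit sphere. -/
def sphereMap (d : ℕ) (U : EuclideanSpace ℂ (Fin d) ≃ₗᵢ[ℂ] EuclideanSpace ℂ (Fin d))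
    (ψ : unitSphere d) : unitSphere d :=
  ⟨U ψ.1, by
    have hψ : ‖(ψ : EuclideanSpace ℂ (Fin d))‖ = 1 := by
      simpa [mem_sphere_iff_norm] using ψ.2

    simp [mem_sphere_iff_norm, U.norm_map, hψ]⟩

instance (d : ℕ) : MeasurableSpace (EuclideanSpace ℂ (Fin d)) := borel _
instance (d : ℕ) : BorelSpace (EuclideanSpace ℂ (Fin d)) := ⟨rfl⟩

/-- `σ` is the rotation-invariant (uniform) probability measure on the unit sphere of `ℂ^d`. -/
def IsUniformSphereMeasure (d : ℕ) (σ : Measure (unitSphere d)) : Prop :=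
  IsProbabilityMeasure σ ∧
    ∀ U : EuclideanSpace ℂ (Fin d) ≃ₗᵢ[ℂ] EuclideanSpace ℂ (Fin d),
      σ.map (sphereMap d U) = σ

/-- The two-way collision probability `p_ψ = Σ_x |ψ_x|⁴`. -/
def pColl (d : ℕ) (ψ : unitSphere d) : ℝ :=
  ∑ x : Fin d, ‖(ψ : EuclideanSpace ℂ (Fin d)) x‖ ^ 4

/-- The three-way collision probability `q_ψ = Σ_x |ψ_x|⁶`. -/
def qColl (d : ℕ) (ψ : unitSphere d) : ℝ :=
  ∑ x : Fin d, ‖(ψ : EuclideanSpace ℂ (Fin d)) x‖ ^ 6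

/-- The unitary acting on the coordinates `i ≠ j` by `(x, y) ↦ (a x + b y, a y - b̄ x)` and fixing
all other coordinates, where `a` is real and `a² + |b|² = 1`. -/
def planeUnitary {d : ℕ} {i j : Fin d} (hij : i ≠ j) (a : ℝ) (b : ℂ)
    (hab : a ^ 2 + Complex.normSq b = 1) :
    EuclideanSpace ℂ (Fin d) ≃ₗᵢ[ℂ] EuclideanSpace ℂ (Fin d) :=
  LinearIsometry.toLinearIsometryEquiv
    { toFun := fun x => WithLp.toLp 2 fun k =>
        if k = i then a * x i + b * x j
        else if k = j then a * x j - starRingEnd ℂ b * x i else x k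
      map_add' := fun x y => by
        ext k
        simp only [PiLp.add_apply]
        split_ifs <;> ring
      map_smul' := fun c x => by
        ext k
        simp only [PiLp.smul_apply, smul_eq_mul, RingHom.id_apply]
        split_ifs <;> ring
      norm_map' := fun x => by
        have hj : j ∈ Finset.univ.erase i := Finset.mem_erase.2 ⟨hij.symm, Finset.mem_univ j⟩
        rw [← sq_eq_sq₀ (norm_nonneg _) (norm_nonneg _), EuclideanSpace.norm_sq_eq,
          EuclideanSpace.norm_sq_eq, ← Finset.add_sum_erase _ _ (Finset.mem_univ i),
          ← Finset.add_sum_erase _ _ (Finset.mem_univ i), ← Finset.add_sum_erase _ _ hj,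
          ← Finset.add_sum_erase _ _ hj, ← add_assoc, ← add_assoc]
        congr 1
        · simp only [LinearMap.coe_mk, AddHom.coe_mk, if_true, if_neg hij.symm, Complex.sq_norm,
            Complex.normSq_apply, Complex.add_re, Complex.add_im, Complex.sub_re, Complex.sub_im,
            Complex.mul_re, Complex.mul_im, Complex.ofReal_re, Complex.ofReal_im,
            Complex.conj_re, Complex.conj_im] at hab ⊢
          linear_combination ((x i).re ^ 2 + (x i).im ^ 2 + (x j).re ^ 2 + (x j).im ^ 2) * hab
        · refine Finset.sum_congr rfl fun k hk => ?_
          simp only [Finset.mem_erase] at hk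
          simp [hk.1, hk.2.1] }
    rfl

lemma planeUnitary_apply_left {d : ℕ} {i j : Fin d} (hij : i ≠ j) (a : ℝ) (b : ℂ)
    (hab : a ^ 2 + Complex.normSq b = 1) (x : EuclideanSpace ℂ (Fin d)) :
    planeUnitary hij a b hab x i = a * x i + b * x j := by
  simp [planeUnitary]

lemma planeUnitary_apply_right {d : ℕ} {i j : Fin d} (hij : i ≠ j) (a : ℝ) (b : ℂ)
    (hab : a ^ 2 + Complex.normSq b = 1) (x : EuclideanSpace ℂ (Fin d)) :
    planeUnitary hij a b hab x j = a * x j - starRingEnd ℂ b * x i := by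
  simp [planeUnitary, hij.symm]

/-- The outcome probability `|ψ_x|²`. -/
def outcomeProb {d : ℕ} (ψ : unitSphere d) (x : Fin d) : ℝ :=
  ‖(ψ : EuclideanSpace ℂ (Fin d)) x‖ ^ 2

lemma sum_outcomeProb {d : ℕ} (ψ : unitSphere d) : ∑ x, outcomeProb ψ x = 1 := by
  have h : ‖(ψ : EuclideanSpace ℂ (Fin d))‖ = 1 := mem_sphere_zero_iff_norm.1 ψ.2
  simp only [outcomeProb]
  rw [← EuclideanSpace.norm_sq_eq, h, one_pow]

@[fun_prop]
lemma continuous_outcomeProb {d : ℕ} (x : Fin d) :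
    Continuous fun ψ : unitSphere d => outcomeProb ψ x := by
  unfold outcomeProb
  fun_prop

lemma pColl_eq_sum_outcomeProb {d : ℕ} (ψ : unitSphere d) :
    pColl d ψ = ∑ x, outcomeProb ψ x ^ 2 := by
  simp only [pColl, outcomeProb, ← pow_mul]

lemma continuous_sphereMap {d : ℕ}
    (U : EuclideanSpace ℂ (Fin d) ≃ₗᵢ[ℂ] EuclideanSpace ℂ (Fin d)) :
    Continuous (sphereMap d U) :=
  (U.continuous.comp continuous_subtype_val).subtype_mk _

lemma integrable_of_continuous {d : ℕ} (σ : Measure (unitSphere d)) [IsFiniteMeasure σ]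
    {f : unitSphere d → ℝ} (hf : Continuous f) : Integrable f σ :=
  hf.integrable_of_hasCompactSupport (HasCompactSupport.of_compactSpace f)

lemma IsUniformSphereMeasure.integral_comp_sphereMap {d : ℕ} {σ : Measure (unitSphere d)}
    (hσ : IsUniformSphereMeasure d σ)
    (U : EuclideanSpace ℂ (Fin d) ≃ₗᵢ[ℂ] EuclideanSpace ℂ (Fin d))
    {f : unitSphere d → ℝ} (hf : Continuous f) :
    ∫ ψ, f (sphereMap d U ψ) ∂σ = ∫ ψ, f ψ ∂σ := by
  conv_rhs => rw [← hσ.2 U]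
  exact (integral_map (continuous_sphereMap U).aemeasurable
    hf.aestronglyMeasurable).symm

/-- Averaging `G(|ψ_i|², |ψ_j|²)` over the balanced rotations of the plane `(i, j)` with relative
phases `1`, `i`, `e^{iπ/4}`, `e^{-iπ/4}`: if the average exceeds `G` by `K`, then `K` has mean
zero. -/
lemma IsUniformSphereMeasure.integral_pair_eq_zero {d : ℕ} {σ : Measure (unitSphere d)}
    (hσ : IsUniformSphereMeasure d σ) {i j : Fin d} (hij : i ≠ j) {G K : ℝ → ℝ → ℝ}
    (hG : Continuous fun p : ℝ × ℝ => G p.1 p.2)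
    (hGK : ∀ u v A B r : ℝ, A ^ 2 + B ^ 2 = u * v → r ^ 2 = 1 / 2 →
      G ((u + v) / 2 + A) ((u + v) / 2 - A) + G ((u + v) / 2 + B) ((u + v) / 2 - B)
        + G ((u + v) / 2 + r * (A + B)) ((u + v) / 2 - r * (A + B))
        + G ((u + v) / 2 + r * (A - B)) ((u + v) / 2 - r * (A - B)) = 4 * (G u v + K u v)) :
    ∫ ψ, K (outcomeProb ψ i) (outcomeProb ψ j) ∂σ = 0 := by
  have := hσ.1
  obtain ⟨r, hr2⟩ : ∃ r : ℝ, r ^ 2 = 1 / 2 := ⟨√(1 / 2), Real.sq_sqrt (by norm_num)⟩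
  let f : unitSphere d → ℝ := fun ψ => G (outcomeProb ψ i) (outcomeProb ψ j)
  have hf : Continuous f :=
    hG.comp ((continuous_outcomeProb i).prodMk (continuous_outcomeProb j))
  have hb1 : r ^ 2 + Complex.normSq ⟨r, 0⟩ = 1 := by
    rw [Complex.normSq_mk]; linear_combination 2 * hr2
  have hb2 : r ^ 2 + Complex.normSq ⟨0, -r⟩ = 1 := by
    rw [Complex.normSq_mk]; linear_combination 2 * hr2
  have hb3 : r ^ 2 + Complex.normSq ⟨1 / 2, -1 / 2⟩ = 1 := by
    rw [Complex.normSq_mk]; linear_combination hr2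
  have hb4 : r ^ 2 + Complex.normSq ⟨1 / 2, 1 / 2⟩ = 1 := by
    rw [Complex.normSq_mk]; linear_combination hr2
  let F (b : ℂ) (hb : r ^ 2 + Complex.normSq b = 1) (ψ : unitSphere d) : ℝ :=
    f (sphereMap d (planeUnitary hij r b hb) ψ)
  have hFc (b : ℂ) (hb : r ^ 2 + Complex.normSq b = 1) : Integrable (F b hb) σ :=
    integrable_of_continuous σ (hf.comp (continuous_sphereMap _))
  have hFi (b : ℂ) (hb : r ^ 2 + Complex.normSq b = 1) : ∫ ψ, F b hb ψ ∂σ = ∫ ψ, f ψ ∂σ :=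
    hσ.integral_comp_sphereMap _ hf
  have key (ψ : unitSphere d) : K (outcomeProb ψ i) (outcomeProb ψ j) =
      (F _ hb1 ψ + F _ hb2 ψ + F _ hb3 ψ + F _ hb4 ψ) / 4 - f ψ := by
    have hF (b : ℂ) (hb : r ^ 2 + Complex.normSq b = 1) (c : ℝ)
        (hc : c = 2 * r * (b * (starRingEnd ℂ (ψ.1 i) * ψ.1 j)).re) : F b hb ψ =
        G ((outcomeProb ψ i + outcomeProb ψ j) / 2 + c)
          ((outcomeProb ψ i + outcomeProb ψ j) / 2 - c) := by
      simp only [F, f, outcomeProb, sphereMap, planeUnitary_apply_left, planeUnitary_apply_right]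
      simp only [Complex.sq_norm, Complex.normSq_apply, Complex.add_re, Complex.add_im,
        Complex.sub_re, Complex.sub_im, Complex.mul_re, Complex.mul_im, Complex.ofReal_re,
        Complex.ofReal_im, Complex.conj_re, Complex.conj_im] at hb hc ⊢
      subst hc
      have hb' : b.re * b.re + b.im * b.im = 1 / 2 := by linear_combination hb - hr2
      congr 1
      · linear_combination (((ψ.1 i).re ^ 2 + (ψ.1 i).im ^ 2)) * hr2
          + ((ψ.1 j).re ^ 2 + (ψ.1 j).im ^ 2) * hb'
      · linear_combination (((ψ.1 j).re ^ 2 + (ψ.1 j).im ^ 2)) * hr2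
          + ((ψ.1 i).re ^ 2 + (ψ.1 i).im ^ 2) * hb'
    generalize hw : starRingEnd ℂ (ψ.1 i) * ψ.1 j = w at hF
    have hwsq : w.re ^ 2 + w.im ^ 2 = outcomeProb ψ i * outcomeProb ψ j := by
      simp only [outcomeProb, Complex.sq_norm, ← Complex.normSq_conj (ψ.1 i), ← map_mul, hw]
      rw [Complex.normSq_apply]
      ring
    rw [hF _ hb1 w.re (by rw [Complex.mul_re]; linear_combination -2 * w.re * hr2),
      hF _ hb2 w.im (by rw [Complex.mul_re]; linear_combination -2 * w.im * hr2),
      hF _ hb3 (r * (w.re + w.im)) (by rw [Complex.mul_re]; ring),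
      hF _ hb4 (r * (w.re - w.im)) (by rw [Complex.mul_re]; ring)]
    linear_combination -(1 / 4) * hGK _ _ _ _ r hwsq hr2
  simp_rw [key]
  have hfi := integrable_of_continuous σ hf
  have h12 := (hFc _ hb1).fun_add (hFc _ hb2)
  have h123 := h12.fun_add (hFc _ hb3)
  have h1234 := h123.fun_add (hFc _ hb4)
  rw [integral_sub (h1234.div_const 4) hfi, integral_div, integral_add h123 (hFc _ hb4),
    integral_add h12 (hFc _ hb3), integral_add (hFc _ hb1) (hFc _ hb2),
    hFi, hFi, hFi, hFi]
  ring

/-- Under the averaging hypothesis, only the diagonal contributes to the mean of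
`Σ_{i,j} K(|ψ_i|², |ψ_j|²)`. -/
lemma IsUniformSphereMeasure.integral_sum_pair {d : ℕ} {σ : Measure (unitSphere d)}
    (hσ : IsUniformSphereMeasure d σ) (G K : ℝ → ℝ → ℝ)
    (hG : Continuous fun p : ℝ × ℝ => G p.1 p.2) (hK : Continuous fun p : ℝ × ℝ => K p.1 p.2)
    (hGK : ∀ u v A B r : ℝ, A ^ 2 + B ^ 2 = u * v → r ^ 2 = 1 / 2 →
      G ((u + v) / 2 + A) ((u + v) / 2 - A) + G ((u + v) / 2 + B) ((u + v) / 2 - B)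
        + G ((u + v) / 2 + r * (A + B)) ((u + v) / 2 - r * (A + B))
        + G ((u + v) / 2 + r * (A - B)) ((u + v) / 2 - r * (A - B)) = 4 * (G u v + K u v)) :
    ∫ ψ, ∑ i, ∑ j, K (outcomeProb ψ i) (outcomeProb ψ j) ∂σ =
      ∫ ψ, ∑ i, K (outcomeProb ψ i) (outcomeProb ψ i) ∂σ := by
  have := hσ.1
  have hc (i j : Fin d) :
      Continuous fun ψ : unitSphere d => K (outcomeProb ψ i) (outcomeProb ψ j) :=
    hK.comp ((continuous_outcomeProb i).prodMk (continuous_outcomeProb j))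
  rw [integral_finsetSum _ fun i _ => integrable_of_continuous σ
      (continuous_finsetSum _ fun j _ => hc i j),
    integral_finsetSum _ fun i _ => integrable_of_continuous σ (hc i i)]
  refine Finset.sum_congr rfl fun i _ => ?_
  rw [integral_finsetSum _ fun j _ => integrable_of_continuous σ (hc i j)]
  exact Finset.sum_eq_single i (fun j _ hj => hσ.integral_pair_eq_zero hj.symm hG hGK) (by simp)

/-- The mean of `Σ_x |ψ_x|^{2k}`. -/
def meanPowerSum (d : ℕ) (σ : Measure (unitSphere d)) (k : ℕ) : ℝ :=
  ∫ ψ, ∑ x, outcomeProb ψ x ^ k ∂σ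

lemma integrable_powerSum {d : ℕ} (σ : Measure (unitSphere d)) [IsFiniteMeasure σ] (k : ℕ) :
    Integrable (fun ψ : unitSphere d => ∑ x, outcomeProb ψ x ^ k) σ :=
  integrable_of_continuous σ (by fun_prop)

lemma IsUniformSphereMeasure.meanPowerSum_two {d : ℕ} {σ : Measure (unitSphere d)}
    (hσ : IsUniformSphereMeasure d σ) : ((d : ℝ) + 1) * meanPowerSum d σ 2 = 2 := by
  have := hσ.1
  have h := hσ.integral_sum_pair (fun u v => -2 * (u ^ 2 + v ^ 2))
    (fun u v => u ^ 2 + v ^ 2 - 4 * (u * v)) (by fun_prop) (by fun_prop)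
    fun u v A B r hw hr => by
      linear_combination -8 * (A ^ 2 + B ^ 2) * hr - 8 * hw
  have hl (ψ : unitSphere d) : ∑ i, ∑ j, (outcomeProb ψ i ^ 2 + outcomeProb ψ j ^ 2
      - 4 * (outcomeProb ψ i * outcomeProb ψ j)) =
      2 * d * ∑ i, outcomeProb ψ i ^ 2 - 4 := by
    simp only [Finset.sum_sub_distrib, Finset.sum_add_distrib, ← Finset.mul_sum, ← Finset.sum_mul,
      sum_outcomeProb, Finset.sum_const, Finset.card_univ, Fintype.card_fin, nsmul_eq_mul]
    ring
  have hr (ψ : unitSphere d) : ∑ i, (outcomeProb ψ i ^ 2 + outcomeProb ψ i ^ 2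
      - 4 * (outcomeProb ψ i * outcomeProb ψ i)) = -2 * ∑ i, outcomeProb ψ i ^ 2 := by
    rw [Finset.mul_sum]
    exact Finset.sum_congr rfl fun i _ => by ring
  simp_rw [hl, hr] at h
  rw [integral_sub ((integrable_powerSum σ 2).const_mul _) (integrable_const _),
    integral_const_mul, integral_const_mul, integral_const, probReal_univ, one_smul] at h
  simp only [meanPowerSum]
  linear_combination h / 2

lemma IsUniformSphereMeasure.meanPowerSum_three {d : ℕ} {σ : Measure (unitSphere d)}
    (hσ : IsUniformSphereMeasure d σ) :
    ((d : ℝ) + 2) * meanPowerSum d σ 3 = 3 * meanPowerSum d σ 2 := by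
  have := hσ.1
  have h := hσ.integral_sum_pair (fun u v => -(4 / 3) * (u ^ 3 + v ^ 3))
    (fun u v => u ^ 3 + v ^ 3 - 3 * (u ^ 2 * v + u * v ^ 2)) (by fun_prop) (by fun_prop)
    fun u v A B r hw hr => by
      linear_combination -8 * (u + v) * (A ^ 2 + B ^ 2) * hr - 8 * (u + v) * hw
  have hl (ψ : unitSphere d) : ∑ i, ∑ j, (outcomeProb ψ i ^ 3 + outcomeProb ψ j ^ 3
      - 3 * (outcomeProb ψ i ^ 2 * outcomeProb ψ j + outcomeProb ψ i * outcomeProb ψ j ^ 2)) =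
      2 * d * ∑ i, outcomeProb ψ i ^ 3 - 6 * ∑ i, outcomeProb ψ i ^ 2 := by
    simp only [Finset.sum_sub_distrib, Finset.sum_add_distrib, ← Finset.mul_sum, ← Finset.sum_mul,
      sum_outcomeProb, Finset.sum_const, Finset.card_univ, Fintype.card_fin, nsmul_eq_mul]
    ring
  have hr (ψ : unitSphere d) : ∑ i, (outcomeProb ψ i ^ 3 + outcomeProb ψ i ^ 3
      - 3 * (outcomeProb ψ i ^ 2 * outcomeProb ψ i + outcomeProb ψ i * outcomeProb ψ i ^ 2)) =
      -4 * ∑ i, outcomeProb ψ i ^ 3 := by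
    rw [Finset.mul_sum]
    exact Finset.sum_congr rfl fun i _ => by ring
  simp_rw [hl, hr] at h
  rw [integral_sub ((integrable_powerSum σ 3).const_mul _) ((integrable_powerSum σ 2).const_mul _),
    integral_const_mul, integral_const_mul, integral_const_mul] at h
  simp only [meanPowerSum]
  linear_combination h / 2

lemma IsUniformSphereMeasure.meanPowerSum_four {d : ℕ} {σ : Measure (unitSphere d)}
    (hσ : IsUniformSphereMeasure d σ) :
    ((d : ℝ) + 3) * meanPowerSum d σ 4 = 4 * meanPowerSum d σ 3 := by
  have := hσ.1
  have h := hσ.integral_sum_pair (fun u v => -2 * (u ^ 4 + v ^ 4) - 12 * (u ^ 2 * v ^ 2))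
    (fun u v => u ^ 4 + v ^ 4 - 4 * (u ^ 3 * v + u * v ^ 3)) (by fun_prop) (by fun_prop)
    fun u v A B r hw hr => by
      have hr4 : r ^ 4 = 1 / 4 := by linear_combination (r ^ 2 + 1 / 2) * hr
      linear_combination -24 * (A ^ 2 + B ^ 2 + u * v) * hw
        - 16 * (2 * A ^ 4 + 12 * A ^ 2 * B ^ 2 + 2 * B ^ 4) * hr4
  have hl (ψ : unitSphere d) : ∑ i, ∑ j, (outcomeProb ψ i ^ 4 + outcomeProb ψ j ^ 4
      - 4 * (outcomeProb ψ i ^ 3 * outcomeProb ψ j + outcomeProb ψ i * outcomeProb ψ j ^ 3)) =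
      2 * d * ∑ i, outcomeProb ψ i ^ 4 - 8 * ∑ i, outcomeProb ψ i ^ 3 := by
    simp only [Finset.sum_sub_distrib, Finset.sum_add_distrib, ← Finset.mul_sum, ← Finset.sum_mul,
      sum_outcomeProb, Finset.sum_const, Finset.card_univ, Fintype.card_fin, nsmul_eq_mul]
    ring
  have hr (ψ : unitSphere d) : ∑ i, (outcomeProb ψ i ^ 4 + outcomeProb ψ i ^ 4
      - 4 * (outcomeProb ψ i ^ 3 * outcomeProb ψ i + outcomeProb ψ i * outcomeProb ψ i ^ 3)) =
      -6 * ∑ i, outcomeProb ψ i ^ 4 := by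
    rw [Finset.mul_sum]
    exact Finset.sum_congr rfl fun i _ => by ring
  simp_rw [hl, hr] at h
  rw [integral_sub ((integrable_powerSum σ 4).const_mul _) ((integrable_powerSum σ 3).const_mul _),
    integral_const_mul, integral_const_mul, integral_const_mul] at h
  simp only [meanPowerSum]
  linear_combination h / 2

lemma continuous_pColl (d : ℕ) : Continuous (pColl d) := by
  simp only [funext pColl_eq_sum_outcomeProb]
  fun_prop

lemma memLp_two_pColl {d : ℕ} (σ : Measure (unitSphere d)) [IsFiniteMeasure σ] :
    MemLp (pColl d) 2 σ :=
  (memLp_two_iff_integrable_sq (continuous_pColl d).aestronglyMeasurable).2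
    (integrable_of_continuous σ ((continuous_pColl d).pow 2))

lemma IsUniformSphereMeasure.integral_pColl_sq {d : ℕ} {σ : Measure (unitSphere d)}
    (hσ : IsUniformSphereMeasure d σ) :
    6 * ∫ ψ, pColl d ψ ^ 2 ∂σ = ((d : ℝ) + 5) * meanPowerSum d σ 4 := by
  have := hσ.1
  have h := hσ.integral_sum_pair (fun u v => 16 * (u ^ 2 * v ^ 2))
    (fun u v => u ^ 4 + v ^ 4 - 12 * (u ^ 2 * v ^ 2)) (by fun_prop) (by fun_prop)
    fun u v A B r hw hr => by
      have hr4 : r ^ 4 = 1 / 4 := by linear_combination (r ^ 2 + 1 / 2) * hr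
      linear_combination -16 * (u + v) ^ 2 * (A ^ 2 + B ^ 2) * hr
        + (24 * (A ^ 2 + B ^ 2 + u * v) - 16 * (u + v) ^ 2) * hw
        + 16 * (2 * A ^ 4 + 12 * A ^ 2 * B ^ 2 + 2 * B ^ 4) * hr4
  have hl (ψ : unitSphere d) : ∑ i, ∑ j, (outcomeProb ψ i ^ 4 + outcomeProb ψ j ^ 4
      - 12 * (outcomeProb ψ i ^ 2 * outcomeProb ψ j ^ 2)) =
      2 * d * ∑ i, outcomeProb ψ i ^ 4 - 12 * pColl d ψ ^ 2 := by
    simp only [Finset.sum_sub_distrib, Finset.sum_add_distrib, ← Finset.mul_sum, ← Finset.sum_mul,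
      pColl_eq_sum_outcomeProb, Finset.sum_const, Finset.card_univ, Fintype.card_fin,
      nsmul_eq_mul]
    ring
  have hr (ψ : unitSphere d) : ∑ i, (outcomeProb ψ i ^ 4 + outcomeProb ψ i ^ 4
      - 12 * (outcomeProb ψ i ^ 2 * outcomeProb ψ i ^ 2)) = -10 * ∑ i, outcomeProb ψ i ^ 4 := by
    rw [Finset.mul_sum]
    exact Finset.sum_congr rfl fun i _ => by ring
  simp_rw [hl, hr] at h
  rw [integral_sub ((integrable_powerSum σ 4).const_mul _)
      ((memLp_two_pColl σ).integrable_sq.const_mul _),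
    integral_const_mul, integral_const_mul, integral_const_mul] at h
  simp only [meanPowerSum]
  linear_combination -h / 2

lemma IsUniformSphereMeasure.integral_pColl {d : ℕ} {σ : Measure (unitSphere d)}
    (hσ : IsUniformSphereMeasure d σ) : ∫ ψ, pColl d ψ ∂σ = 2 / ((d : ℝ) + 1) := by
  rw [eq_div_iff (by positivity), mul_comm, ← hσ.meanPowerSum_two]
  simp only [pColl_eq_sum_outcomeProb, meanPowerSum]

lemma IsUniformSphereMeasure.variance_pColl {d : ℕ} {σ : Measure (unitSphere d)}
    (hσ : IsUniformSphereMeasure d σ) :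
    ProbabilityTheory.variance (pColl d) σ =
      4 * ((d : ℝ) - 1) / (((d : ℝ) + 1) ^ 2 * ((d : ℝ) + 2) * ((d : ℝ) + 3)) := by
  have := hσ.1
  have hsq : ∫ ψ, pColl d ψ ^ 2 ∂σ =
      4 * ((d : ℝ) + 5) / (((d : ℝ) + 1) * ((d : ℝ) + 2) * ((d : ℝ) + 3)) := by
    rw [eq_div_iff (by positivity)]
    linear_combination ((d : ℝ) + 1) * ((d : ℝ) + 2) * ((d : ℝ) + 3) / 6 * hσ.integral_pColl_sq
      + ((d : ℝ) + 5) * ((d : ℝ) + 1) * ((d : ℝ) + 2) / 6 * hσ.meanPowerSum_four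
      + 4 * ((d : ℝ) + 5) * ((d : ℝ) + 1) / 6 * hσ.meanPowerSum_three
      + 12 * ((d : ℝ) + 5) / 6 * hσ.meanPowerSum_two
  rw [ProbabilityTheory.variance_eq_sub (memLp_two_pColl σ), hσ.integral_pColl]
  simp only [Pi.pow_apply]
  rw [hsq]
  field_simp
  ring

/-- Deviation bound for the two-way collision probability:
`σ(|p_ψ - 2/(d+1)| ≥ 1/(100d)) ≤ 40000/d`. -/
theorem pColl_deviation (d : ℕ) (hd : 1 ≤ d) (σ : Measure (unitSphere d))
    (hσ : IsUniformSphereMeasure d σ) :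
    σ {ψ : unitSphere d | 1 / (100 * (d : ℝ)) ≤ |pColl d ψ - 2 / ((d : ℝ) + 1)|}
      ≤ ENNReal.ofReal (40000 / (d : ℝ)) := by
  have := hσ.1
  have hd0 : (0 : ℝ) < d := by exact_mod_cast hd
  have h := ProbabilityTheory.meas_ge_le_variance_div_sq (memLp_two_pColl σ)
    (c := 1 / (100 * (d : ℝ))) (by positivity)
  rw [hσ.integral_pColl, hσ.variance_pColl] at h
  refine h.trans (ENNReal.ofReal_le_ofReal ?_)
  rw [div_div, div_le_div_iff₀ (by positivity) hd0, div_pow, one_pow, mul_one_div, mul_div_assoc',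
    le_div_iff₀ (by positivity)]
  nlinarith [pow_pos hd0 2, pow_pos hd0 3, pow_pos hd0 4]
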